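/- Let A be a commutative ring with 2 invertible and B a commutative A-algebra. With C and J̃_{ij} as above (the quotient of B^{⊗3} by I_{01}² + I_{02}² + I_{12}²), the B-module J̃_{01} · J̃_{12} (with B acting through the 0-th factor) is canonically isomorphic to Λ² Ω¹_{B/A}, via the map sending dy ∧ dy' to the class of (1⊗y⊗1 − y⊗1⊗1)(1⊗1⊗y' − 1⊗y'⊗1). -/

import Mathlib

open scoped TensorProduct
open PiTensorProduct

variable (A B : Type) [CommRing A] [CommRing B] [Algebra A B]

abbrev Bpow (n : ℕ) : Type := ⨂[A] (_ : Fin n), B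

noncomputable def rmap {m n : ℕ} (r : Fin m → Fin n) : Bpow A B m →ₐ[A] Bpow A B n :=
  PiTensorProduct.liftAlgHom
    ((MultilinearMap.mkPiAlgebra A (Fin m) (Bpow A B n)).compLinearMap
      (fun k => (PiTensorProduct.singleAlgHom (R := A) (A := fun _ : Fin n => B) (r k)).toLinearMap))
    (by simp [← PiTensorProduct.one_def])
    (by intro x y
        simp only [MultilinearMap.compLinearMap_apply, MultilinearMap.mkPiAlgebra_apply,
          Pi.mul_apply, AlgHom.toLinearMap_apply, _root_.map_mul, Finset.prod_mul_distrib])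

noncomputable def mergeN (n i j : ℕ) (hij : i < j) (hj : j ≤ n) :
    Bpow A B (n+1) →ₐ[A] Bpow A B n :=
  rmap A B (fun k => if h1 : k.val < j then ⟨k.val, by omega⟩
    else if h2 : k.val = j then ⟨i, by omega⟩
    else ⟨k.val - 1, by have := k.isLt; omega⟩)

noncomputable def Iideal (n i j : ℕ) (hij : i < j) (hj : j ≤ n) : Ideal (Bpow A B (n+1)) :=
  RingHom.ker (mergeN A B n i j hij hj)

noncomputable def Kideal (n : ℕ) : Ideal (Bpow A B (n+1)) :=
  ⨆ (i : ℕ) (j : ℕ) (hij : i < j) (hj : j ≤ n), (Iideal A B n i j hij hj) ^ 2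

abbrev Cq (n : ℕ) : Type := Bpow A B (n+1) ⧸ Kideal A B n

noncomputable def Jt (n i j : ℕ) (hij : i < j) (hj : j ≤ n) : Ideal (Cq A B n) :=
  Ideal.map (Ideal.Quotient.mk (Kideal A B n)) (Iideal A B n i j hij hj)

noncomputable def dElt (n i j : ℕ) (hi : i ≤ n) (hj : j ≤ n) (y : B) : Bpow A B (n+1) :=
  PiTensorProduct.singleAlgHom (R := A) (A := fun _ : Fin (n+1) => B) ⟨j, by omega⟩ y
    - PiTensorProduct.singleAlgHom (R := A) (A := fun _ : Fin (n+1) => B) ⟨i, by omega⟩ y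

noncomputable def insN (n j : ℕ) (hj : j ≤ n+1) : Bpow A B (n+1) →ₐ[A] Bpow A B (n+2) :=
  rmap A B (fun k => if h : k.val < j then ⟨k.val, by omega⟩
    else ⟨k.val + 1, by have := k.isLt; omega⟩)

noncomputable def eN (n : ℕ) : Bpow A B (n+1) →ₗ[A] Bpow A B (n+2) :=
  ∑ j : Fin (n+2), ((-1 : ℤ) ^ (j : ℕ)) • (insN A B n j (by omega)).toLinearMap

noncomputable def smashG (m n N : ℕ) (h : N = m + n) (x : Bpow A B (m+1)) (y : Bpow A B (n+1)) :
    Bpow A B (N+1) :=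
  rmap A B (fun k : Fin (m+1) => (⟨k.val, by have := k.isLt; omega⟩ : Fin (N+1))) x *
  rmap A B (fun k : Fin (n+1) => (⟨m + k.val, by have := k.isLt; omega⟩ : Fin (N+1))) y

/-- The wedge `dy₁ ∧ ⋯ ∧ dyₙ`-style elements of the `n`-th exterior power. -/
noncomputable def wedgeD (n : ℕ) (f : Fin n → Ω[B⁄A]) : ⋀[B]^n (Ω[B⁄A]) :=
  ⟨ExteriorAlgebra.ιMulti B n f, ExteriorAlgebra.ιMulti_range B n (Set.mem_range_self f)⟩

/-- `B`-algebra structure on `C_n` through the 0-th tensor factor. -/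
noncomputable instance instAlgebraBCq (n : ℕ) : Algebra B (Cq A B n) :=
  ((Ideal.Quotient.mk (Kideal A B n)).comp
    (PiTensorProduct.singleAlgHom (R := A) (A := fun _ : Fin (n+1) => B) 0).toRingHom).toAlgebra


section Helpers

variable {A B}

lemma Nat.zero_le_two : 0 ≤ 2 := Nat.zero_le 2

lemma Nat.two_le_two : 2 ≤ 2 := le_rfl

lemma Nat.one_le_two : 1 ≤ 2 := Nat.le_succ 1

local notation "d01" => dElt A B 2 0 1 Nat.zero_le_two Nat.one_le_two
local notation "I01" => Iideal A B 2 0 1 Nat.zero_lt_one Nat.one_le_two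
local notation "d12" => dElt A B 2 1 2 Nat.one_le_two Nat.two_le_two
local notation "I12" => Iideal A B 2 1 2 Nat.one_lt_two Nat.two_le_two
local notation "d02" => dElt A B 2 0 2 Nat.zero_le_two Nat.two_le_two

local notation "sg" => PiTensorProduct.singleAlgHom (R := A) (A := fun _ : Fin (2 + 1) => B)

lemma rmap_tprod {m n : ℕ} (r : Fin m → Fin n) (f : Fin m → B) :
    rmap A B r (PiTensorProduct.tprod A f) =
      ∏ k, PiTensorProduct.singleAlgHom (R := A) (A := fun _ : Fin n => B) (r k) (f k) :=
  PiTensorProduct.lift.tprod f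

lemma rmap_singleAlgHom {m n : ℕ} (r : Fin m → Fin n) (k : Fin m) (b : B) :
    rmap A B r (PiTensorProduct.singleAlgHom (R := A) (A := fun _ : Fin m => B) k b) =
      PiTensorProduct.singleAlgHom (R := A) (A := fun _ : Fin n => B) (r k) b := by
  rw [PiTensorProduct.singleAlgHom_apply, rmap_tprod, Finset.prod_eq_single k]
  · simp
  · intro i _ hi
    rw [MonoidHom.mulSingle_apply, Pi.mulSingle_eq_of_ne hi, map_one]
  · simp

/-- The kernel of merging the `j`-th factor into the `i`-th one is generated by the differences of
the two insertions of elements of `B`. -/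
lemma Iideal_eq_span (n i j : ℕ) (hij : i < j) (hj : j ≤ n) :
    Iideal A B n i j hij hj = Ideal.span (Set.range (dElt A B n i j (by omega) hj)) := by
  apply le_antisymm
  · intro x hx
    set I := Ideal.span (Set.range (dElt A B n i j (by omega) hj))
    let s : Bpow A B n →ₐ[A] Bpow A B (n + 1) :=
      rmap A B (fun k => if k.val < j then ⟨k.val, by omega⟩ else ⟨k.val + 1, by omega⟩)
    have key : Ideal.Quotient.mkₐ A I =
        (Ideal.Quotient.mkₐ A I).comp (s.comp (mergeN A B n i j hij hj)) := by
      ext k b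
      simp only [AlgHom.comp_apply, mergeN, s, rmap_singleAlgHom]
      by_cases hk : k.val = j
      · rw [Ideal.Quotient.mkₐ_eq_mk, Ideal.Quotient.mk_eq_mk_iff_sub_mem]
        refine Ideal.subset_span ⟨b, ?_⟩
        obtain ⟨k, hkn⟩ := k
        subst hk
        simp [dElt, hij]
      · refine congrArg (fun k => Ideal.Quotient.mkₐ A I (PiTensorProduct.singleAlgHom k b))
          (Fin.ext ?_)
        rcases lt_or_gt_of_ne hk with h | h
        · simp [h]
        · have h1 : ¬ k.val < j := by omega
          have h2 : ¬ k.val - 1 < j := by omega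
          simp only [dif_neg h1, dif_neg hk, if_neg h2]
          omega
    have := DFunLike.congr_fun key x
    have hx' : mergeN A B n i j hij hj x = 0 := hx
    rw [AlgHom.comp_apply, AlgHom.comp_apply, hx', map_zero, map_zero] at this
    exact Ideal.Quotient.eq_zero_iff_mem.mp this
  · rw [Ideal.span_le]
    rintro _ ⟨y, rfl⟩
    change mergeN A B n i j hij hj _ = 0
    rw [dElt, map_sub, mergeN, rmap_singleAlgHom, rmap_singleAlgHom, sub_eq_zero]
    congr 2
    apply Fin.ext
    simp [hij]

lemma dElt_mem_Iideal (n i j : ℕ) (hij : i < j) (hj : j ≤ n) (y : B) :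
    dElt A B n i j (by omega) hj y ∈ Iideal A B n i j hij hj := by
  rw [Iideal_eq_span]
  exact Ideal.subset_span ⟨y, rfl⟩

lemma Iideal_sq_le (n i j : ℕ) (hij : i < j) (hj : j ≤ n) :
    Iideal A B n i j hij hj ^ 2 ≤ Kideal A B n :=
  le_iSup_of_le i <| le_iSup_of_le j <| le_iSup_of_le hij <| le_iSup_of_le hj le_rfl

lemma mk_mul_eq_zero {n i j : ℕ} {hij : i < j} {hj : j ≤ n} {x y : Bpow A B (n + 1)}
    (hx : x ∈ Iideal A B n i j hij hj) (hy : y ∈ Iideal A B n i j hij hj) :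
    Ideal.Quotient.mk (Kideal A B n) x * Ideal.Quotient.mk (Kideal A B n) y = 0 := by
  rw [← map_mul, Ideal.Quotient.eq_zero_iff_mem]
  exact Iideal_sq_le n i j hij hj (by rw [pow_two]; exact Ideal.mul_mem_mul hx hy)

lemma algebraMap_Cq_apply (n : ℕ) (b : B) : algebraMap B (Cq A B n) b =
    Ideal.Quotient.mk (Kideal A B n)
      (PiTensorProduct.singleAlgHom (R := A) (A := fun _ : Fin (n + 1) => B) 0 b) := rfl

instance (n : ℕ) : IsScalarTower A B (Cq A B n) :=
  IsScalarTower.of_algebraMap_eq fun a => by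
    rw [algebraMap_Cq_apply, AlgHom.commutes]
    rfl

/-- The derivation `y ↦ 1 ⊗ ⋯ ⊗ y ⊗ ⋯ ⊗ 1 - y ⊗ 1 ⊗ ⋯ ⊗ 1` with `y` in the `j`-th factor. -/
noncomputable def dDer (n j : ℕ) (hj0 : 0 < j) (hj : j ≤ n) : Derivation A B (Cq A B n) :=
  Derivation.mk' ((Ideal.Quotient.mkₐ A (Kideal A B n)).toLinearMap ∘ₗ
    ((PiTensorProduct.singleAlgHom (R := A) (A := fun _ : Fin (n + 1) => B)
        ⟨j, by omega⟩).toLinearMap -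
      (PiTensorProduct.singleAlgHom (R := A) (A := fun _ : Fin (n + 1) => B) 0).toLinearMap))
    fun a b => by
      have h := mk_mul_eq_zero (dElt_mem_Iideal (A := A) n 0 j hj0 hj a)
        (dElt_mem_Iideal (A := A) n 0 j hj0 hj b)
      simp only [dElt, map_sub] at h
      simp only [LinearMap.comp_apply, LinearMap.sub_apply, AlgHom.toLinearMap_apply, map_mul,
        Ideal.Quotient.mkₐ_eq_mk, map_sub, Algebra.smul_def, algebraMap_Cq_apply]
      have e : (⟨0, by omega⟩ : Fin (n + 1)) = 0 := rfl
      rw [e] at h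
      linear_combination h

lemma dDer_apply (n j : ℕ) (hj0 : 0 < j) (hj : j ≤ n) (y : B) :
    dDer (A := A) (B := B) n j hj0 hj y =
      Ideal.Quotient.mk (Kideal A B n) (dElt A B n 0 j (by omega) hj y) := rfl

/-- The bilinear map `(dy, dy') ↦ (1⊗y⊗1 - y⊗1⊗1)(1⊗1⊗y' - y'⊗1⊗1)`. -/
noncomputable def dProd : Ω[B⁄A] →ₗ[B] Ω[B⁄A] →ₗ[B] Cq A B 2 :=
  (LinearMap.mul B (Cq A B 2)).compl₁₂
    (dDer (A := A) (B := B) 2 1 Nat.zero_lt_one Nat.one_le_two).liftKaehlerDifferential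
    (dDer (A := A) (B := B) 2 2 Nat.zero_lt_two Nat.two_le_two).liftKaehlerDifferential

lemma dProd_D (y y' : B) :
    dProd (KaehlerDifferential.D A B y) (KaehlerDifferential.D A B y') =
      Ideal.Quotient.mk (Kideal A B 2)
        (d01 y * d12 y') := by
  have h := mk_mul_eq_zero (dElt_mem_Iideal (A := A) 2 0 1 Nat.zero_lt_one Nat.one_le_two y)
    (dElt_mem_Iideal (A := A) 2 0 1 Nat.zero_lt_one Nat.one_le_two y')
  have e : d02 y' =
      d12 y' + d01 y' := by
    simp only [dElt]; ring
  simp only [dProd, LinearMap.compl₁₂_apply, LinearMap.mul_apply',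
    Derivation.liftKaehlerDifferential_comp_D, dDer_apply]
  rw [e, map_add, mul_add, h, add_zero, map_mul]

lemma KaehlerDifferential.bilin_ext {M : Type*} [AddCommGroup M] [Module B M]
    {f g : Ω[B⁄A] →ₗ[B] Ω[B⁄A] →ₗ[B] M}
    (h : ∀ y y', f (KaehlerDifferential.D A B y) (KaehlerDifferential.D A B y') =
      g (KaehlerDifferential.D A B y) (KaehlerDifferential.D A B y')) : f = g :=
  LinearMap.ext_on_range (KaehlerDifferential.span_range_derivation A B) fun y =>
    LinearMap.ext_on_range (KaehlerDifferential.span_range_derivation A B) fun y' => h y y'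

lemma dProd_add_flip : dProd (A := A) (B := B) + dProd.flip = 0 := by
  refine KaehlerDifferential.bilin_ext fun y y' => ?_
  have h (i j hij hj) := mk_mul_eq_zero (dElt_mem_Iideal (A := A) 2 i j hij hj y)
    (dElt_mem_Iideal (A := A) 2 i j hij hj y')
  have h01 := h 0 1 Nat.zero_lt_one Nat.one_le_two
  have h12 := h 1 2 Nat.one_lt_two Nat.two_le_two
  have h02 := h 0 2 Nat.zero_lt_two Nat.two_le_two
  simp only [LinearMap.add_apply, LinearMap.flip_apply, dProd_D, LinearMap.zero_apply]
  simp only [dElt, map_mul, map_sub] at *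
  linear_combination h02 - h12 - h01

lemma dProd_self (h2 : IsUnit (2 : A)) (x : Ω[B⁄A]) : dProd x x = 0 := by
  have h : dProd x x + dProd x x = 0 :=
    DFunLike.congr_fun (DFunLike.congr_fun (dProd_add_flip (A := A) (B := B)) x) x
  rw [← two_smul A] at h
  exact h2.smul_eq_zero.mp h

/-- An alternating bilinear map as an alternating map on pairs. -/
noncomputable def altOfBilin {M N : Type*} [AddCommGroup M] [Module B M] [AddCommGroup N]
    [Module B N] (f : M →ₗ[B] M →ₗ[B] N) (hf : ∀ x, f x x = 0) : M [⋀^Fin 2]→ₗ[B] N where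
  toFun v := f (v 0) (v 1)
  map_update_add' v i x y := by
    fin_cases i <;> simp
  map_update_smul' v i c x := by
    fin_cases i <;> simp
  map_eq_zero_of_eq' v i j h hij := by
    fin_cases i <;> fin_cases j <;> simp_all

/-- `dy ∧ dy' ↦ (1⊗y⊗1 - y⊗1⊗1)(1⊗1⊗y' - y'⊗1⊗1)` as a linear map into `C`. -/
noncomputable def wedgeToCq (h2 : IsUnit (2 : A)) : ⋀[B]^2 (Ω[B⁄A]) →ₗ[B] Cq A B 2 :=
  exteriorPower.alternatingMapLinearEquiv (altOfBilin dProd (dProd_self h2))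

lemma wedgeToCq_ιMulti (h2 : IsUnit (2 : A)) (v : Fin 2 → Ω[B⁄A]) :
    wedgeToCq (B := B) h2 (exteriorPower.ιMulti B 2 v) = dProd (v 0) (v 1) :=
  exteriorPower.alternatingMapLinearEquiv_apply_ιMulti _ _

lemma span_wedge_D : Submodule.span B (Set.range fun p : B × B =>
    exteriorPower.ιMulti B 2 ![KaehlerDifferential.D A B p.1, KaehlerDifferential.D A B p.2]) =
      ⊤ := by
  rw [← exteriorPower.ιMulti_span_of_span B 2 _ (KaehlerDifferential.span_range_derivation A B)]
  congr 1
  ext x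
  constructor
  · rintro ⟨p, rfl⟩
    refine ⟨_, ?_, rfl⟩
    rintro _ ⟨i, rfl⟩
    fin_cases i
    exacts [⟨p.1, rfl⟩, ⟨p.2, rfl⟩]
  · rintro ⟨v, hv, rfl⟩
    obtain ⟨y, hy⟩ := hv ⟨0, rfl⟩
    obtain ⟨y', hy'⟩ := hv ⟨1, rfl⟩
    refine ⟨(y, y'), congrArg _ ?_⟩
    ext i
    fin_cases i
    exacts [hy, hy']

lemma range_wedgeToCq_eq_span (h2 : IsUnit (2 : A)) : LinearMap.range (wedgeToCq (B := B) h2) =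
    Submodule.span B (Set.range fun p : B × B => Ideal.Quotient.mk (Kideal A B 2)
      (d01 p.1 * d12 p.2)) := by
  rw [LinearMap.range_eq_map, ← span_wedge_D, Submodule.map_span, ← Set.range_comp]
  congr 2
  ext p
  exact (wedgeToCq_ιMulti h2 _).trans (dProd_D _ _)

/-- Multiplication `B ⊗ ⋯ ⊗ B → B`. -/
noncomputable def totalMul (n : ℕ) : Bpow A B n →ₐ[A] B :=
  PiTensorProduct.liftAlgHom (A := fun _ => B) (MultilinearMap.mkPiAlgebra A (Fin n) B) (by simp)
    (by simp [Finset.prod_mul_distrib])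

lemma totalMul_singleAlgHom (n : ℕ) (k : Fin n) (b : B) : totalMul n
    (PiTensorProduct.singleAlgHom (R := A) (A := fun _ : Fin n => B) k b) = b :=
  (PiTensorProduct.lift.tprod _).trans (by simp [Finset.prod_pi_mulSingle'])

lemma sub_totalMul_mem (x : Bpow A B (2 + 1)) :
    x - sg 0 (totalMul (2 + 1) x) ∈ I01 ⊔
      I12 := by
  set I := I01 ⊔ I12
  have key : Ideal.Quotient.mkₐ A I =
      (Ideal.Quotient.mkₐ A I).comp ((sg 0).comp (totalMul (2 + 1))) := by
    ext k b
    simp only [AlgHom.comp_apply, totalMul_singleAlgHom]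
    rw [Ideal.Quotient.mkₐ_eq_mk, Ideal.Quotient.mk_eq_mk_iff_sub_mem]
    have h1 : sg 1 b - sg 0 b ∈ I :=
      Ideal.mem_sup_left (dElt_mem_Iideal 2 0 1 Nat.zero_lt_one Nat.one_le_two b)
    have h2 : sg 2 b - sg 1 b ∈ I :=
      Ideal.mem_sup_right (dElt_mem_Iideal 2 1 2 Nat.one_lt_two Nat.two_le_two b)
    fin_cases k
    · simp
    · exact h1
    · simpa using add_mem h2 h1
  have := DFunLike.congr_fun key x
  rwa [AlgHom.comp_apply, AlgHom.comp_apply, Ideal.Quotient.mkₐ_eq_mk,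
    Ideal.Quotient.mk_eq_mk_iff_sub_mem] at this

lemma mk_mul_dElt_mul_dElt (x : Bpow A B (2 + 1)) (y y' : B) :
    Ideal.Quotient.mk (Kideal A B 2) (x *
      (d01 y * d12 y')) =
    totalMul (2 + 1) x • Ideal.Quotient.mk (Kideal A B 2)
      (d01 y * d12 y') := by
  obtain ⟨u, hu, v, hv, huv⟩ := Submodule.mem_sup.mp (sub_totalMul_mem x)
  have h1 := mk_mul_eq_zero hu (dElt_mem_Iideal 2 0 1 Nat.zero_lt_one Nat.one_le_two y)
  have h2 := mk_mul_eq_zero hv (dElt_mem_Iideal 2 1 2 Nat.one_lt_two Nat.two_le_two y')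
  have h := congrArg (Ideal.Quotient.mk (Kideal A B 2)) huv
  rw [Algebra.smul_def, algebraMap_Cq_apply]
  simp only [map_mul, map_add, map_sub] at h ⊢
  linear_combination Ideal.Quotient.mk (Kideal A B 2)
    (d12 y') * h1 + Ideal.Quotient.mk (Kideal A B 2)
    (d01 y) * h2 - Ideal.Quotient.mk (Kideal A B 2)
    (d01 y) * Ideal.Quotient.mk (Kideal A B 2)
    (d12 y') * h

lemma range_wedgeToCq (h2 : IsUnit (2 : A)) : LinearMap.range (wedgeToCq (B := B) h2) =
    Submodule.restrictScalars B
      ((Jt A B 2 0 1 Nat.zero_lt_one Nat.one_le_two * Jt A B 2 1 2 Nat.one_lt_two Nat.two_le_two :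
        Ideal (Cq A B 2)) : Submodule (Cq A B 2) (Cq A B 2)) := by
  rw [range_wedgeToCq_eq_span]
  apply le_antisymm
  · rw [Submodule.span_le]
    rintro _ ⟨p, rfl⟩
    dsimp only
    rw [map_mul]
    exact Ideal.mul_mem_mul (Ideal.mem_map_of_mem _ (dElt_mem_Iideal 2 0 1 _ _ _))
      (Ideal.mem_map_of_mem _ (dElt_mem_Iideal 2 1 2 _ _ _))
  · intro z hz
    rw [Submodule.restrictScalars_mem, Jt, Jt, Iideal_eq_span, Iideal_eq_span, ← Ideal.map_mul,
      Ideal.span_mul_span', Ideal.map_span] at hz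
    induction hz using Submodule.span_induction with
    | mem z hz =>
      obtain ⟨_, ⟨_, ⟨y, rfl⟩, _, ⟨y', rfl⟩, rfl⟩, rfl⟩ := hz
      exact Submodule.subset_span ⟨(y, y'), rfl⟩
    | zero => exact zero_mem _
    | add _ _ _ _ h h' => exact add_mem h h'
    | smul c z _ h =>
      obtain ⟨x, rfl⟩ := Ideal.Quotient.mk_surjective c
      clear * - h
      induction h using Submodule.span_induction with
      | mem z hz =>
        obtain ⟨p, rfl⟩ := hz
        rw [smul_eq_mul, ← map_mul, mk_mul_dElt_mul_dElt]
        exact Submodule.smul_mem _ _ (Submodule.subset_span ⟨p, rfl⟩)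
      | zero => rw [smul_zero]; exact zero_mem _
      | add _ _ _ _ h h' => rw [smul_add]; exact add_mem h h'
      | smul b z _ h =>
        rw [smul_comm]
        exact Submodule.smul_mem _ _ h

/-- The exterior product `x ∧ y` as a bilinear map. -/
noncomputable def wedge : Ω[B⁄A] →ₗ[B] Ω[B⁄A] →ₗ[B] ⋀[B]^2 (Ω[B⁄A]) :=
  LinearMap.mk₂ B (fun x y => exteriorPower.ιMulti B 2 ![x, y])
    (fun x x' y => Subtype.ext (by simp [ExteriorAlgebra.ιMulti_apply, add_mul]))
    (fun c x y => Subtype.ext (by simp [ExteriorAlgebra.ιMulti_apply]))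
    (fun x y y' => Subtype.ext (by simp [ExteriorAlgebra.ιMulti_apply, mul_add]))
    (fun c x y => Subtype.ext (by simp [ExteriorAlgebra.ιMulti_apply]))

lemma wedge_self (x : Ω[B⁄A]) : wedge x x = 0 :=
  (exteriorPower.ιMulti B 2).map_eq_zero_of_eq ![x, x] (i := 0) (j := 1) rfl (by decide)

lemma wedge_swap (x y : Ω[B⁄A]) : wedge x y = -wedge y x := by
  have h := wedge_self (x + y)
  simp only [map_add, LinearMap.add_apply, wedge_self, zero_add, add_zero] at h
  exact eq_neg_of_add_eq_zero_right h

/-- The map `b₀ ⊗ b₁ ⊗ b₂ ↦ b₀ • (db₁ ∧ db₂)`. -/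
noncomputable def toWedge : Bpow A B (2 + 1) →ₗ[A] ⋀[B]^2 (Ω[B⁄A]) :=
  PiTensorProduct.lift <| MultilinearMap.mk'
    (fun f => f 0 • wedge (KaehlerDifferential.D A B (f 1)) (KaehlerDifferential.D A B (f 2)))
    (fun f i x y => by fin_cases i <;> simp [Function.update, add_smul])
    (fun f i c x => by
      fin_cases i <;> simp [Function.update] <;> exact smul_comm (f 0) c _)

lemma toWedge_tprod (f : Fin (2 + 1) → B) : toWedge (PiTensorProduct.tprod A f) =
    f 0 • wedge (KaehlerDifferential.D A B (f 1)) (KaehlerDifferential.D A B (f 2)) :=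
  PiTensorProduct.lift.tprod f

lemma toWedge_mul_dElt_mul_dElt (i j : ℕ) (hij : i < j) (hj : j ≤ 2) (y y' : B)
    (x : Bpow A B (2 + 1)) :
    toWedge (x * (dElt A B 2 i j (by omega) hj y * dElt A B 2 i j (by omega) hj y')) = 0 := by
  suffices toWedge ∘ₗ LinearMap.mulRight A
      (dElt A B 2 i j (by omega) hj y * dElt A B 2 i j (by omega) hj y') = 0 from
    DFunLike.congr_fun this x
  refine PiTensorProduct.ext (MultilinearMap.ext fun f => ?_)
  simp only [LinearMap.compMultilinearMap_apply, LinearMap.comp_apply, LinearMap.mulRight_apply,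
    dElt, PiTensorProduct.singleAlgHom_apply, mul_sub, sub_mul, PiTensorProduct.tprod_mul_tprod,
    map_sub, toWedge_tprod, LinearMap.zero_apply]
  have hs := wedge_swap (KaehlerDifferential.D A B y') (KaehlerDifferential.D A B y)
  obtain ⟨rfl, rfl⟩ | ⟨rfl, rfl⟩ | ⟨rfl, rfl⟩ :
      i = 0 ∧ j = 1 ∨ i = 0 ∧ j = 2 ∨ i = 1 ∧ j = 2 := by omega
  all_goals
    simp [hs, smul_smul]
    module

lemma toWedge_eq_zero {x : Bpow A B (2 + 1)} (hx : x ∈ Kideal A B 2) : toWedge x = 0 := by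
  let N : Ideal (Bpow A B (2 + 1)) :=
    { carrier := {z | ∀ p, toWedge (p * z) = 0}
      add_mem' h h' p := by rw [mul_add, map_add, h, h', add_zero]
      zero_mem' p := by rw [mul_zero, map_zero]
      smul_mem' c z h p := by rw [smul_eq_mul, ← mul_assoc]; exact h _ }
  suffices Kideal A B 2 ≤ N by simpa using this hx 1
  refine iSup_le fun i => iSup_le fun j => iSup_le fun hij => iSup_le fun hj => ?_
  rw [Iideal_eq_span, pow_two, Ideal.span_mul_span', Ideal.span_le]
  rintro _ ⟨_, ⟨y, rfl⟩, _, ⟨y', rfl⟩, rfl⟩ p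
  exact toWedge_mul_dElt_mul_dElt i j hij hj y y' p

lemma toWedge_singleAlgHom_mul (b : B) (x : Bpow A B (2 + 1)) :
    toWedge (sg 0 b * x) = b • toWedge x := by
  suffices toWedge ∘ₗ LinearMap.mulLeft A (sg 0 b) =
      (LinearMap.lsmul B _ b).restrictScalars A ∘ₗ toWedge from
    DFunLike.congr_fun this x
  refine PiTensorProduct.ext (MultilinearMap.ext fun f => ?_)
  simpa [toWedge_tprod, PiTensorProduct.tprod_mul_tprod, mul_smul] using smul_comm _ _ _

/-- The map `C → Λ² Ω` induced by `b₀ ⊗ b₁ ⊗ b₂ ↦ b₀ • (db₁ ∧ db₂)`. -/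
noncomputable def cqToWedge : Cq A B 2 →ₗ[B] ⋀[B]^2 (Ω[B⁄A]) where
  __ := QuotientAddGroup.lift (Kideal A B 2).toAddSubgroup toWedge.toAddMonoidHom
    fun _ hx => toWedge_eq_zero hx
  map_smul' b z := by
    obtain ⟨x, rfl⟩ := Ideal.Quotient.mk_surjective z
    exact toWedge_singleAlgHom_mul b x

lemma cqToWedge_mk (x : Bpow A B (2 + 1)) :
    cqToWedge (A := A) (B := B) (Ideal.Quotient.mk (Kideal A B 2) x) = toWedge x := rfl

lemma cqToWedge_wedgeToCq (h2 : IsUnit (2 : A)) (x : ⋀[B]^2 (Ω[B⁄A])) :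
    cqToWedge (A := A) (B := B) (wedgeToCq (B := B) h2 x) = x := by
  suffices cqToWedge (A := A) (B := B) ∘ₗ wedgeToCq h2 = LinearMap.id from DFunLike.congr_fun this x
  refine LinearMap.ext_on_range span_wedge_D fun p => ?_
  rw [LinearMap.comp_apply, wedgeToCq_ιMulti]
  change cqToWedge (A := A) (B := B)
      (dProd (KaehlerDifferential.D A B p.1) (KaehlerDifferential.D A B p.2)) =
    wedge (KaehlerDifferential.D A B p.1) (KaehlerDifferential.D A B p.2)
  rw [dProd_D, cqToWedge_mk]
  simp [dElt, mul_sub, sub_mul, toWedge_tprod, PiTensorProduct.tprod_mul_tprod]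

end Helpers

/-- If `2` is invertible in `A`, the `B`-module `J̃₀₁·J̃₁₂ ⊆ C`
(`B` acting through the 0-th factor) is canonically isomorphic to `Λ² Ω¹_{B/A}`, via
`dy ∧ dy' ↦ (1⊗y⊗1 − y⊗1⊗1)(1⊗1⊗y' − 1⊗y'⊗1)`. -/
theorem statement7 (h2 : IsUnit (2 : A)) :
    ∃ e : (⋀[B]^2 (Ω[B⁄A])) ≃ₗ[B]
        (Submodule.restrictScalars B
          ((Jt A B 2 0 1 (by omega) (by omega) * Jt A B 2 1 2 (by omega) (by omega) :
            Ideal (Cq A B 2)) : Submodule (Cq A B 2) (Cq A B 2))),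
      ∀ y y' : B,
        (e (wedgeD A B 2 ![KaehlerDifferential.D A B y, KaehlerDifferential.D A B y'])
            : Cq A B 2)
          = Ideal.Quotient.mk (Kideal A B 2)
              (dElt A B 2 0 1 (by omega) (by omega) y *
               dElt A B 2 1 2 (by omega) (by omega) y') := by
  refine ⟨(LinearEquiv.ofInjective (wedgeToCq (B := B) h2)
    (Function.LeftInverse.injective (cqToWedge_wedgeToCq h2))).trans
      (LinearEquiv.ofEq _ _ (range_wedgeToCq h2)), fun y y' => ?_⟩
  exact (wedgeToCq_ιMulti h2 _).trans (dProd_D y y')
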